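/- arXiv:2406.15644 — 3 statements merged into one kernel-verified Lean document; each statement's English description precedes it below -/
import Mathlib

section
/- Fix γ > 1 and take λ̃(χ) = 1/(γχ − 1) (i.e. γ̃(χ) = γχ), so Q(V) = (ρ, ρu, ρv, ρκ + p/(γχ−1), ρχ) with κ = (u²+v²)/2, defined for γχ ≠ 1. For any two states V₁ = (ρ₁, u₁, v₁, p₁, χ₁) and V₂ = (ρ₂, u₂, v₂, p₂, χ₂) with γχ₁ ≠ 1 and γχ₂ ≠ 1, let T̂⁻¹(V₁, V₂) be the 5×5 matrix with rows (1, 0, 0, 0, 0), (ū, ρ̄, 0, 0, 0), (v̄, 0, ρ̄, 0, 0), (κ̄, ρ̄ū, ρ̄v̄, (γ̃̄ − 1)/((γ̃₁ − 1)(γ̃₂ − 1)), β̄), (χ̄, 0, 0, 0, ρ̄), where x̄ := (x₁+x₂)/2 denotes the arithmetic average, γ̃_j = γχ_j, γ̃̄ = (γ̃₁+γ̃₂)/2, κ̄ = (κ₁+κ₂)/2, and β̄ = −γ p̄ / ((γ̃₁ − 1)(γ̃₂ − 1)). Then the exact Roe-type identity Q(V₂) − Q(V₁) = T̂⁻¹(V₁,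 V₂) (V₂ − V₁) holds. -/
open Matrix

/-- Exact Roe-type identity Q(V₂) − Q(V₁) = T̂⁻¹(V₁,V₂)(V₂ − V₁) with arithmetic
averages, for the EOS λ̃(χ) = 1/(γχ − 1), i.e. γ̃(χ) = γχ. -/
theorem roe_identity_eos2
    (γ : ℝ) (hγ : 1 < γ)
    (ρ₁ u₁ v₁ p₁ χ₁ ρ₂ u₂ v₂ p₂ χ₂ : ℝ)
    (h₁ : γ * χ₁ - 1 ≠ 0) (h₂ : γ * χ₂ - 1 ≠ 0) :
    (![ρ₂, ρ₂ * u₂, ρ₂ * v₂, ρ₂ * (u₂ ^ 2 + v₂ ^ 2) / 2 + p₂ / (γ * χ₂ - 1),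
        ρ₂ * χ₂] : Fin 5 → ℝ)
      - ![ρ₁, ρ₁ * u₁, ρ₁ * v₁, ρ₁ * (u₁ ^ 2 + v₁ ^ 2) / 2 + p₁ / (γ * χ₁ - 1),
          ρ₁ * χ₁]
    = (!![1, 0, 0, 0, 0;
          (u₁ + u₂) / 2, (ρ₁ + ρ₂) / 2, 0, 0, 0;
          (v₁ + v₂) / 2, 0, (ρ₁ + ρ₂) / 2, 0, 0;
          ((u₁ ^ 2 + v₁ ^ 2) / 2 + (u₂ ^ 2 + v₂ ^ 2) / 2) / 2,
            (ρ₁ + ρ₂) / 2 * ((u₁ + u₂) / 2), (ρ₁ + ρ₂) / 2 * ((v₁ + v₂) / 2),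
            ((γ * χ₁ + γ * χ₂) / 2 - 1) / ((γ * χ₁ - 1) * (γ * χ₂ - 1)),
            -(γ * ((p₁ + p₂) / 2)) / ((γ * χ₁ - 1) * (γ * χ₂ - 1));
          (χ₁ + χ₂) / 2, 0, 0, 0, (ρ₁ + ρ₂) / 2] : Matrix (Fin 5) (Fin 5) ℝ).mulVec
        (![ρ₂, u₂, v₂, p₂, χ₂] - ![ρ₁, u₁, v₁, p₁, χ₁]) := by
  ext i
  fin_cases i <;> simp [Matrix.mulVec, dotProduct, Fin.sum_univ_succ]
  · ring
  · ring
  · field_simp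
    ring
  · ring
end

section
/- Let γ > 1 and let λ̃ : ℝ → ℝ be differentiable. Define the conservative normal flux 𝔽_n on the open set {Q ∈ ℝ⁵ : Q₁ ≠ 0, λ̃(Q₅/Q₁) ≠ 0} by p(Q) = (Q₄ − (Q₂² + Q₃²)/(2Q₁)) / λ̃(Q₅/Q₁) and 𝔽_n(Q) = n_x (Q₂, Q₂²/Q₁ + p(Q), Q₂Q₃/Q₁, (Q₄ + p(Q))Q₂/Q₁, Q₂Q₅/Q₁) + n_y (Q₃, Q₂Q₃/Q₁, Q₃²/Q₁ + p(Q), (Q₄ + p(Q))Q₃/Q₁, Q₃Q₅/Q₁). For V = (ρ,u,v,p,χ) with ρ ≠ 0 and λ̃(χ) ≠ 0, let Q(V) = (ρ, ρu, ρv, ρκ + λ̃(χ)p, ρχ), let T⁻¹(V) be the 5×5 matrix with rows (1,0,0,0,0), (u,ρ,0,0,0), (v,0,ρ,0,0), (κ, ρu, ρv, λ̃(χ), pλ̃′(χ)), (χ,0,0,0,ρ), and let A_V, B_V be the primitive quasilinear matrices with γ̃ = 1 + 1/λ̃(χ). Then the intertwining relation (D𝔽_n)(Q(V)) · T⁻¹(V)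 = T⁻¹(V) · (A_V(V) n_x + B_V(V) n_y) holds, where D𝔽_n denotes the Jacobian matrix of 𝔽_n in conservative variables; equivalently A_V n_x + B_V n_y = T (D𝔽_n)(Q(V)) T⁻¹ with T = (T⁻¹)⁻¹. -/
open Matrix

/-- Primitive quasilinear matrix A_V of the multi-material Euler system. -/
noncomputable def AVmat (ρ u v p γt : ℝ) : Matrix (Fin 5) (Fin 5) ℝ :=
  !![u, ρ, 0, 0, 0;
     0, u, 0, 1/ρ, 0;
     0, 0, u, 0, 0;
     0, γt*p, 0, u, 0;
     0, 0, 0, 0, u]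

/-- Primitive quasilinear matrix B_V of the multi-material Euler system. -/
noncomputable def BVmat (ρ u v p γt : ℝ) : Matrix (Fin 5) (Fin 5) ℝ :=
  !![v, 0, ρ, 0, 0;
     0, v, 0, 0, 0;
     0, 0, v, 1/ρ, 0;
     0, 0, γt*p, v, 0;
     0, 0, 0, 0, v]

/-- Jacobian T⁻¹(V) = ∂Q/∂V for a general EOS coefficient λ̃. -/
noncomputable def TinvMat (lam : ℝ → ℝ) (ρ u v p χ : ℝ) : Matrix (Fin 5) (Fin 5) ℝ :=
  !![1, 0, 0, 0, 0;
     u, ρ, 0, 0, 0;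
     v, 0, ρ, 0, 0;
     (u ^ 2 + v ^ 2) / 2, ρ * u, ρ * v, lam χ, p * deriv lam χ;
     χ, 0, 0, 0, ρ]

/-- Pressure expressed in terms of the conservative variables. -/
noncomputable def presQ (lam : ℝ → ℝ) (Q : Fin 5 → ℝ) : ℝ :=
  (Q 3 - (Q 1 ^ 2 + Q 2 ^ 2) / (2 * Q 0)) / lam (Q 4 / Q 0)

/-- Conservative normal flux 𝔽_n of the multi-material Euler system. -/
noncomputable def consFlux (lam : ℝ → ℝ) (nx ny : ℝ) (Q : Fin 5 → ℝ) : Fin 5 → ℝ :=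
  fun i =>
    nx * (![Q 1, Q 1 ^ 2 / Q 0 + presQ lam Q, Q 1 * Q 2 / Q 0,
            (Q 3 + presQ lam Q) * Q 1 / Q 0, Q 1 * Q 4 / Q 0] i)
  + ny * (![Q 2, Q 1 * Q 2 / Q 0, Q 2 ^ 2 / Q 0 + presQ lam Q,
            (Q 3 + presQ lam Q) * Q 2 / Q 0, Q 2 * Q 4 / Q 0] i)

/-- Map from primitive to conservative variables. -/
noncomputable def consOfPrim (lam : ℝ → ℝ) (ρ u v p χ : ℝ) : Fin 5 → ℝ :=
  ![ρ, ρ * u, ρ * v, ρ * (u ^ 2 + v ^ 2) / 2 + lam χ * p, ρ * χ]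

/-- Quotient rule for Fréchet derivatives of real-valued functions. -/
theorem hasFDerivAt_fun_div {E : Type*} [NormedAddCommGroup E] [NormedSpace ℝ E] {f g : E → ℝ}
    {f' g' : E →L[ℝ] ℝ} {x : E} (hf : HasFDerivAt f f' x) (hg : HasFDerivAt g g' x)
    (hx : g x ≠ 0) :
    HasFDerivAt (fun y => f y / g y) ((g x)⁻¹ • f' - (f x / g x ^ 2) • g') x := by
  convert hf.fun_mul ((hasDerivAt_inv hx).comp_hasFDerivAt x hg) using 1
  all_goals
    ext w
    simp [div_eq_mul_inv]
  ring

/-- Differential of the pressure at the conservative state of a primitive state. -/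
theorem hasFDerivAt_presQ_consOfPrim {lam : ℝ → ℝ} {ρ u v p χ : ℝ}
    (hlam : DifferentiableAt ℝ lam χ) (hρ : ρ ≠ 0) (hl : lam χ ≠ 0) :
    ∃ P : (Fin 5 → ℝ) →L[ℝ] ℝ, HasFDerivAt (presQ lam) P (consOfPrim lam ρ u v p χ) ∧
      ∀ w, P w = (w 3 - u * w 1 - v * w 2 + (u ^ 2 + v ^ 2) / 2 * w 0
        - p * deriv lam χ * (w 4 - χ * w 0) / ρ) / lam χ := by
  have hQ (i : Fin 5) : HasFDerivAt (fun Q : Fin 5 → ℝ => Q i)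
      (ContinuousLinearMap.proj (R := ℝ) (φ := fun _ : Fin 5 => ℝ) i)
      (consOfPrim lam ρ u v p χ) := hasFDerivAt_apply i _
  have hχ : consOfPrim lam ρ u v p χ 4 / consOfPrim lam ρ u v p χ 0 = χ := by
    simp [consOfPrim, hρ]
  have h0 : consOfPrim lam ρ u v p χ 0 ≠ 0 := by simpa [consOfPrim] using hρ
  have h20 : 2 * consOfPrim lam ρ u v p χ 0 ≠ 0 := mul_ne_zero two_ne_zero h0
  have hlam' : HasDerivAt lam (deriv lam χ)
      (consOfPrim lam ρ u v p χ 4 / consOfPrim lam ρ u v p χ 0) := by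
    rw [hχ]; exact hlam.hasDerivAt
  refine ⟨_, hasFDerivAt_fun_div ((hQ 3).fun_sub (hasFDerivAt_fun_div (((hQ 1).pow 2).fun_add
    ((hQ 2).pow 2)) ((hQ 0).const_mul 2) h20))
    (hlam'.comp_hasFDerivAt (f := fun Q : Fin 5 → ℝ => Q 4 / Q 0) _
      (hasFDerivAt_fun_div (hQ 4) (hQ 0) h0)) (by simpa [hχ] using hl), fun w => ?_⟩
  simp [hχ]
  simp [consOfPrim]
  field_simp
  ring

/-- Differential of the flux components at the conservative state of a primitive state. -/
theorem fderiv_consFlux_consOfPrim {lam : ℝ → ℝ} {ρ u v p χ : ℝ} (nx ny : ℝ)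
    (hlam : DifferentiableAt ℝ lam χ) (hρ : ρ ≠ 0) (hl : lam χ ≠ 0) (i : Fin 5)
    (w : Fin 5 → ℝ) :
    fderiv ℝ (fun Q => consFlux lam nx ny Q i) (consOfPrim lam ρ u v p χ) w =
      let dp := (w 3 - u * w 1 - v * w 2 + (u ^ 2 + v ^ 2) / 2 * w 0
        - p * deriv lam χ * (w 4 - χ * w 0) / ρ) / lam χ
      let H := (u ^ 2 + v ^ 2) / 2 + (lam χ + 1) * p / ρ
      nx * ![w 1, 2 * u * w 1 - u ^ 2 * w 0 + dp, u * w 2 + v * w 1 - u * v * w 0,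
        u * (w 3 + dp) + H * (w 1 - u * w 0), u * w 4 + χ * (w 1 - u * w 0)] i
      + ny * ![w 2, u * w 2 + v * w 1 - u * v * w 0, 2 * v * w 2 - v ^ 2 * w 0 + dp,
        v * (w 3 + dp) + H * (w 2 - v * w 0), v * w 4 + χ * (w 2 - v * w 0)] i := by
  obtain ⟨P, hP, hPw⟩ := hasFDerivAt_presQ_consOfPrim (u := u) (v := v) (p := p) hlam hρ hl
  have hQ (i : Fin 5) : HasFDerivAt (fun Q : Fin 5 → ℝ => Q i)
      (ContinuousLinearMap.proj (R := ℝ) (φ := fun _ : Fin 5 => ℝ) i)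
      (consOfPrim lam ρ u v p χ) := hasFDerivAt_apply i _
  have h0 : consOfPrim lam ρ u v p χ 0 ≠ 0 := by simpa [consOfPrim] using hρ
  have hp : presQ lam (consOfPrim lam ρ u v p χ) = p := by
    simp [presQ, consOfPrim, hρ]
    field_simp
    ring
  dsimp only
  rw [← hPw]
  have hmul (j k : Fin 5) := hasFDerivAt_fun_div ((hQ j).fun_mul (hQ k)) (hQ 0) h0
  have hsq (j : Fin 5) := (hasFDerivAt_fun_div ((hQ j).pow 2) (hQ 0) h0).fun_add hP
  have hen (j : Fin 5) := hasFDerivAt_fun_div (((hQ 3).fun_add hP).fun_mul (hQ j)) (hQ 0) h0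
  fin_cases i
  · refine (congrArg (· w) (((hQ 1).const_mul nx).fun_add ((hQ 2).const_mul ny)).fderiv).trans ?_
    simp
  · refine (congrArg (· w) (((hsq 1).const_mul nx).fun_add
      ((hmul 1 2).const_mul ny)).fderiv).trans ?_
    simp [consOfPrim]
    field_simp
  · refine (congrArg (· w) (((hmul 1 2).const_mul nx).fun_add
      ((hsq 2).const_mul ny)).fderiv).trans ?_
    simp [consOfPrim]
    field_simp
  · refine (congrArg (· w) (((hen 1).const_mul nx).fun_add
      ((hen 2).const_mul ny)).fderiv).trans ?_
    simp [hp]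
    simp [consOfPrim]
    field_simp
    ring
  · refine (congrArg (· w) (((hmul 1 4).const_mul nx).fun_add
      ((hmul 2 4).const_mul ny)).fderiv).trans ?_
    simp [consOfPrim]
    field_simp
    ring

/-- Intertwining relation (D𝔽_n)(Q(V)) · T⁻¹(V) = T⁻¹(V) · (A_V n_x + B_V n_y),
with γ̃ = 1 + 1/λ̃(χ). -/
theorem intertwining_conservative_primitive
    (γ : ℝ) (hγ : 1 < γ) (lam : ℝ → ℝ) (hlam : Differentiable ℝ lam)
    (ρ u v p χ nx ny : ℝ) (hρ : ρ ≠ 0) (hl : lam χ ≠ 0) :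
    (Matrix.of fun i j =>
        fderiv ℝ (fun Q => consFlux lam nx ny Q i) (consOfPrim lam ρ u v p χ)
          (Pi.single j 1))
      * TinvMat lam ρ u v p χ
    = TinvMat lam ρ u v p χ
      * (nx • AVmat ρ u v p (1 + 1 / lam χ) + ny • BVmat ρ u v p (1 + 1 / lam χ)) := by
  ext i k
  simp only [Matrix.mul_apply, Matrix.of_apply,
    fderiv_consFlux_consOfPrim nx ny (hlam χ) hρ hl, Fin.sum_univ_five]
  fin_cases i <;> fin_cases k <;> simp [TinvMat, AVmat, BVmat] <;>
    field_simp <;> ring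
end

section
/- Fix γ > 1 and ε > 0, and on ℝ² define r² = (x−5)² + (y−5)², the temperature perturbation δT(x,y) = −((γ−1)ε²/(8γπ²)) e^{1 − r²}, and the fields ρ = (1 + δT)^{1/(γ−1)}, p = (1 + δT)^{γ/(γ−1)}, (u, v) = (ε/(2π)) e^{(1−r²)/2} (−(y−5), x−5), ρE = p/(γ−1) + ρ(u²+v²)/2. Assume 1 + δT > 0 on the region considered (true e.g. when (γ−1)ε² e / (8γπ²) < 1). Then these fields form a stationary solution of the two-dimensional compressible Euler equations: at every such point, ∂_x(ρu) + ∂_y(ρv) = 0, ∂_x(ρu² + p) + ∂_y(ρuv) = 0, ∂_x(ρuv) + ∂_y(ρv² + p) = 0, and ∂_x(u(ρE + p)) + ∂_y(v(ρE + p)) = 0. -/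
open Real

/-- Squared distance to the vortex center (5,5). -/
noncomputable def rsq (q : ℝ × ℝ) : ℝ := (q.1 - 5) ^ 2 + (q.2 - 5) ^ 2

/-- Temperature perturbation of the Shu-type vortex. -/
noncomputable def deltaT (γ ε : ℝ) (q : ℝ × ℝ) : ℝ :=
  -((γ - 1) * ε ^ 2 / (8 * γ * π ^ 2)) * Real.exp (1 - rsq q)

/-- Density field of the Shu-type vortex. -/
noncomputable def vortRho (γ ε : ℝ) (q : ℝ × ℝ) : ℝ :=
  (1 + deltaT γ ε q) ^ ((1 : ℝ) / (γ - 1))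

/-- Pressure field of the Shu-type vortex. -/
noncomputable def vortP (γ ε : ℝ) (q : ℝ × ℝ) : ℝ :=
  (1 + deltaT γ ε q) ^ (γ / (γ - 1))

/-- x-velocity of the Shu-type vortex. -/
noncomputable def vortU (γ ε : ℝ) (q : ℝ × ℝ) : ℝ :=
  ε / (2 * π) * Real.exp ((1 - rsq q) / 2) * (-(q.2 - 5))

/-- y-velocity of the Shu-type vortex. -/
noncomputable def vortV (γ ε : ℝ) (q : ℝ × ℝ) : ℝ :=
  ε / (2 * π) * Real.exp ((1 - rsq q) / 2) * (q.1 - 5)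

/-- Total energy density of the Shu-type vortex. -/
noncomputable def vortE (γ ε : ℝ) (q : ℝ × ℝ) : ℝ :=
  vortP γ ε q / (γ - 1) + vortRho γ ε q * (vortU γ ε q ^ 2 + vortV γ ε q ^ 2) / 2

/-- Partial derivative in the x-direction. -/
noncomputable def ddx (f : ℝ × ℝ → ℝ) (q : ℝ × ℝ) : ℝ := fderiv ℝ f q (1, 0)

/-- Partial derivative in the y-direction. -/
noncomputable def ddy (f : ℝ × ℝ → ℝ) (q : ℝ × ℝ) : ℝ := fderiv ℝ f q (0, 1)

/-- The differential of `rsq / 2` at `q`. -/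
noncomputable def radialForm (q : ℝ × ℝ) : ℝ × ℝ →L[ℝ] ℝ :=
  (q.1 - 5) • ContinuousLinearMap.fst ℝ ℝ ℝ + (q.2 - 5) • ContinuousLinearMap.snd ℝ ℝ ℝ

theorem radialForm_apply (q w : ℝ × ℝ) :
    radialForm q w = (q.1 - 5) * w.1 + (q.2 - 5) * w.2 := by
  simp [radialForm]

theorem hasFDerivAt_fst_sub (q : ℝ × ℝ) :
    HasFDerivAt (fun q : ℝ × ℝ => q.1 - 5) (ContinuousLinearMap.fst ℝ ℝ ℝ) q :=
  hasFDerivAt_fst.sub_const 5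

theorem hasFDerivAt_snd_sub (q : ℝ × ℝ) :
    HasFDerivAt (fun q : ℝ × ℝ => q.2 - 5) (ContinuousLinearMap.snd ℝ ℝ ℝ) q :=
  hasFDerivAt_snd.sub_const 5

theorem hasFDerivAt_rsq (q : ℝ × ℝ) : HasFDerivAt rsq ((2 : ℝ) • radialForm q) q := by
  refine (((hasFDerivAt_fst_sub q).pow 2).add ((hasFDerivAt_snd_sub q).pow 2)).congr_fderiv ?_
  ext <;> simp [radialForm]

/-- A function of `rsq` has a differential proportional to `radialForm`. -/
theorem HasDerivAt.comp_rsq {g : ℝ → ℝ} {g' : ℝ} {q : ℝ × ℝ} (hg : HasDerivAt g g' (rsq q)) :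
    HasFDerivAt (fun q => g (rsq q)) ((2 * g') • radialForm q) q := by
  refine (hg.comp_hasFDerivAt q (hasFDerivAt_rsq q)).congr_fderiv ?_
  rw [smul_smul, mul_comm]

/-- The angular velocity of the vortex. -/
noncomputable def vortOmega (ε : ℝ) (q : ℝ × ℝ) : ℝ :=
  ε / (2 * π) * Real.exp ((1 - rsq q) / 2)

theorem hasFDerivAt_vortOmega (ε : ℝ) (q : ℝ × ℝ) :
    HasFDerivAt (vortOmega ε) (-vortOmega ε q • radialForm q) q := by
  have h := ((((hasDerivAt_id (rsq q)).const_sub 1).div_const 2).exp.const_mul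
    (ε / (2 * π))).comp_rsq
  refine h.congr_fderiv ?_
  congr 1
  simp only [vortOmega, id]
  ring

theorem vortOmega_sq (ε : ℝ) (q : ℝ × ℝ) :
    vortOmega ε q ^ 2 = ε ^ 2 / (4 * π ^ 2) * Real.exp (1 - rsq q) := by
  have h : Real.exp (1 - rsq q) = Real.exp ((1 - rsq q) / 2) ^ 2 := by
    rw [← Real.exp_nat_mul]
    congr 1
    push_cast
    ring
  rw [h, vortOmega]
  ring

theorem hasFDerivAt_deltaT_rpow {γ : ℝ} (hγ : 1 < γ) (ε a : ℝ) {q : ℝ × ℝ}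
    (hq : 0 < 1 + deltaT γ ε q) :
    HasFDerivAt (fun q => (1 + deltaT γ ε q) ^ a)
      ((a * (1 + deltaT γ ε q) ^ (a - 1) * ((γ - 1) / γ * vortOmega ε q ^ 2)) • radialForm q)
      q := by
  have h := ((((((hasDerivAt_id (rsq q)).const_sub 1).exp.const_mul
    (-((γ - 1) * ε ^ 2 / (8 * γ * π ^ 2)))).const_add 1).rpow_const (p := a)
      (Or.inl hq.ne'))).comp_rsq
  refine h.congr_fderiv ?_
  congr 1
  have hγ0 : γ ≠ 0 := by linarith
  simp only [vortOmega_sq, deltaT, id]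
  field_simp
  ring

theorem hasFDerivAt_vortP {γ : ℝ} (hγ : 1 < γ) (ε : ℝ) {q : ℝ × ℝ}
    (hq : 0 < 1 + deltaT γ ε q) :
    HasFDerivAt (vortP γ ε) ((vortRho γ ε q * vortOmega ε q ^ 2) • radialForm q) q := by
  refine (hasFDerivAt_deltaT_rpow hγ ε (γ / (γ - 1)) hq).congr_fderiv ?_
  have hγ0 : γ ≠ 0 := by linarith
  have hγ1 : γ - 1 ≠ 0 := by linarith
  have he : γ / (γ - 1) - 1 = 1 / (γ - 1) := by
    field_simp
    ring
  rw [he, vortRho]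
  congr 1
  field_simp

theorem hasFDerivAt_vortU (γ ε : ℝ) (q : ℝ × ℝ) :
    HasFDerivAt (vortU γ ε)
      (vortOmega ε q • -ContinuousLinearMap.snd ℝ ℝ ℝ
        + (-(q.2 - 5)) • (-vortOmega ε q • radialForm q)) q :=
  (hasFDerivAt_vortOmega ε q).mul (hasFDerivAt_snd_sub q).neg

theorem hasFDerivAt_vortV (γ ε : ℝ) (q : ℝ × ℝ) :
    HasFDerivAt (vortV γ ε)
      (vortOmega ε q • ContinuousLinearMap.fst ℝ ℝ ℝ
        + (q.1 - 5) • (-vortOmega ε q • radialForm q)) q :=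
  (hasFDerivAt_vortOmega ε q).mul (hasFDerivAt_fst_sub q)

/-- The isentropic Shu-type vortex is a stationary solution of the 2D Euler
equations. -/
theorem shu_vortex_stationary (γ ε : ℝ) (hγ : 1 < γ) (hε : 0 < ε)
    (hpos : ∀ q : ℝ × ℝ, 0 < 1 + deltaT γ ε q) :
    ∀ q : ℝ × ℝ,
      ddx (fun q => vortRho γ ε q * vortU γ ε q) q
        + ddy (fun q => vortRho γ ε q * vortV γ ε q) q = 0 ∧
      ddx (fun q => vortRho γ ε q * vortU γ ε q ^ 2 + vortP γ ε q) q
        + ddy (fun q => vortRho γ ε q * vortU γ ε q * vortV γ ε q) q = 0 ∧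
      ddx (fun q => vortRho γ ε q * vortU γ ε q * vortV γ ε q) q
        + ddy (fun q => vortRho γ ε q * vortV γ ε q ^ 2 + vortP γ ε q) q = 0 ∧
      ddx (fun q => vortU γ ε q * (vortE γ ε q + vortP γ ε q)) q
        + ddy (fun q => vortV γ ε q * (vortE γ ε q + vortP γ ε q)) q = 0 := by
  intro q
  have hu : vortU γ ε q = vortOmega ε q * (-(q.2 - 5)) := rfl
  have hv : vortV γ ε q = vortOmega ε q * (q.1 - 5) := rfl
  have dU := hasFDerivAt_vortU γ ε q
  have dV := hasFDerivAt_vortV γ ε q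
  have dP := hasFDerivAt_vortP hγ ε (hpos q)
  obtain ⟨r, dR⟩ : ∃ r : ℝ, HasFDerivAt (vortRho γ ε) (r • radialForm q) q :=
    ⟨_, hasFDerivAt_deltaT_rpow hγ ε (1 / (γ - 1)) (hpos q)⟩
  have dE : HasFDerivAt (vortE γ ε) _ q :=
    (dP.mul_const (γ - 1)⁻¹).add ((dR.mul ((dU.pow 2).add (dV.pow 2))).mul_const 2⁻¹)
  have dH := dE.add dP
  refine ⟨?_, ?_, ?_, ?_⟩
  · have h1 := (dR.mul dU).fderiv
    have h2 := (dR.mul dV).fderiv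
    simp only [ddx, ddy]
    erw [h1, h2]
    simp [radialForm_apply, hu, hv]
    ring
  · have h1 := ((dR.mul (dU.pow 2)).add dP).fderiv
    have h2 := ((dR.mul dU).mul dV).fderiv
    simp only [ddx, ddy]
    erw [h1, h2]
    simp [radialForm_apply, hu, hv]
    ring
  · have h1 := ((dR.mul dU).mul dV).fderiv
    have h2 := ((dR.mul (dV.pow 2)).add dP).fderiv
    simp only [ddx, ddy]
    erw [h1, h2]
    simp [radialForm_apply, hu, hv]
    ring
  · have h1 := (dU.mul dH).fderiv
    have h2 := (dV.mul dH).fderiv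
    simp only [ddx, ddy]
    erw [h1, h2]
    simp [radialForm_apply, hu, hv]
    ring
end
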